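/- Let A be a real n×n matrix, C a real m×n matrix, L and N real n×m matrices, θ a symmetric positive semidefinite real m×m matrix, and P a symmetric positive definite real n×n matrix such that (A − L*C)ᵀP + P*(A − L*C) is negative definite and P*N*C + Cᵀ*Nᵀ*P is negative semidefinite. Let e : ℝ → (Fin n → ℝ) be any solution of the cubic observer error dynamics e' = f(e), where f(e) = (A − L*C) *ᵥ e + (e ⬝ᵥ ((Cᵀ*θ*C) *ᵥ e)) • ((N*C) *ᵥ e). Then the Lyapunov function V(t) = e(t) ⬝ᵥ (P *ᵥ e(t)) is nonincreasing on ℝ: for all s ≤ t, V(t) ≤ V(s). (Monotonicity consequence of Theorem 1.) -/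

import Mathlib

open Matrix

theorem HasDerivAt.dotProduct_fun {ι : Type*} [Fintype ι] {f g : ℝ → ι → ℝ} {f' g' : ι → ℝ}
    {t : ℝ} (hf : HasDerivAt f f' t) (hg : HasDerivAt g g' t) :
    HasDerivAt (fun s => f s ⬝ᵥ g s) (f' ⬝ᵥ g t + f t ⬝ᵥ g') t := by
  simp only [dotProduct, ← Finset.sum_add_distrib]
  exact HasDerivAt.fun_sum fun i _ => (hasDerivAt_pi.1 hf i).mul (hasDerivAt_pi.1 hg i)

theorem HasDerivAt.const_mulVec {ι κ : Type*} [Fintype ι] [Fintype κ] (M : Matrix κ ι ℝ)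
    {g : ℝ → ι → ℝ} {g' : ι → ℝ} {t : ℝ} (hg : HasDerivAt g g' t) :
    HasDerivAt (fun s => M *ᵥ g s) (M *ᵥ g') t := by
  rw [hasDerivAt_pi]
  intro i
  simpa [mulVec] using (hasDerivAt_const t (M i)).dotProduct_fun hg

theorem Matrix.dotProduct_lyapunov_mulVec {ι : Type*} [Fintype ι] (M P : Matrix ι ι ℝ)
    (v : ι → ℝ) :
    v ⬝ᵥ ((Mᵀ * P + P * M) *ᵥ v) = (M *ᵥ v) ⬝ᵥ (P *ᵥ v) + v ⬝ᵥ (P *ᵥ (M *ᵥ v)) := by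
  rw [add_mulVec, dotProduct_add, ← mulVec_mulVec, ← mulVec_mulVec, dotProduct_mulVec v Mᵀ,
    vecMul_transpose]

/-- Monotonicity consequence of Theorem 1: along any solution of the cubic
observer error dynamics, the Lyapunov function `V(t) = e(t)ᵀ P e(t)` is
nonincreasing on ℝ. -/
theorem cubic_observer_thm1_lyapunov_antitone {n m : ℕ}
    (A P : Matrix (Fin n) (Fin n) ℝ) (C : Matrix (Fin m) (Fin n) ℝ)
    (L N : Matrix (Fin n) (Fin m) ℝ) (θ : Matrix (Fin m) (Fin m) ℝ)
    (hθsymm : θᵀ = θ)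
    (hθpsd : ∀ w : Fin m → ℝ, 0 ≤ w ⬝ᵥ (θ *ᵥ w))
    (hPsymm : Pᵀ = P)
    (hPpos : ∀ v : Fin n → ℝ, v ≠ 0 → 0 < v ⬝ᵥ (P *ᵥ v))
    (hLyap : ∀ v : Fin n → ℝ, v ≠ 0 →
      v ⬝ᵥ (((A - L * C)ᵀ * P + P * (A - L * C)) *ᵥ v) < 0)
    (hNsd : ∀ v : Fin n → ℝ, v ⬝ᵥ ((P * N * C + Cᵀ * Nᵀ * P) *ᵥ v) ≤ 0)
    (e : ℝ → (Fin n → ℝ))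
    (hsol : ∀ t : ℝ, HasDerivAt e
      ((A - L * C) *ᵥ (e t) +
        ((e t) ⬝ᵥ ((Cᵀ * θ * C) *ᵥ (e t))) • ((N * C) *ᵥ (e t))) t) :
    ∀ s t : ℝ, s ≤ t → (e t) ⬝ᵥ (P *ᵥ (e t)) ≤ (e s) ⬝ᵥ (P *ᵥ (e s)) := by
  have hθ (v : Fin n → ℝ) : 0 ≤ v ⬝ᵥ ((Cᵀ * θ * C) *ᵥ v) := by
    rw [Matrix.mul_assoc, ← mulVec_mulVec, dotProduct_mulVec, vecMul_transpose, ← mulVec_mulVec]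
    exact hθpsd _
  have hL (v : Fin n → ℝ) :
      v ⬝ᵥ (((A - L * C)ᵀ * P + P * (A - L * C)) *ᵥ v) ≤ 0 := by
    rcases eq_or_ne v 0 with rfl | hv
    · simp
    · exact (hLyap v hv).le
  have hN (v : Fin n → ℝ) :
      (N * C) *ᵥ v ⬝ᵥ (P *ᵥ v) + v ⬝ᵥ (P *ᵥ ((N * C) *ᵥ v)) ≤ 0 := by
    rw [← dotProduct_lyapunov_mulVec, transpose_mul, add_comm, ← Matrix.mul_assoc P]
    exact hNsd v
  have hV (t : ℝ) := (hsol t).dotProduct_fun ((hsol t).const_mulVec P)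
  intro s t hst
  refine antitone_of_hasDerivAt_nonpos hV (fun t => ?_) hst
  have h₁ := hL (e t)
  rw [dotProduct_lyapunov_mulVec] at h₁
  have h₂ := mul_nonpos_of_nonneg_of_nonpos (hθ (e t)) (hN (e t))
  simp only [add_dotProduct, mulVec_add, dotProduct_add, mulVec_smul, smul_dotProduct,
    dotProduct_smul, smul_eq_mul, Pi.zero_apply]
  linarith
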